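/- arXiv:1910.11098 — 2 statements merged into one kernel-verified Lean document; each statement's English description precedes it below -/
import Mathlib

section
/- Let K be a field of odd characteristic containing i with i^2 = -1, and let t ∈ K with t(t^4 - 1) ≠ 0. The orbit of t under the A₄-subgroup of PGL(2,K) generated by x ↦ -x and x ↦ (x-i)/(x+i) consists of the 12 elements t, -t, (t-i)/(t+i), -(t-i)/(t+i), (t+i)/(t-i), -(t+i)/(t-i), -i(t+1)/(t-1), i(t+1)/(t-1), -i(t-1)/(t+1), i(t-1)/(t+1), -1/t, 1/t, and the product ∏(X - z) over these 12 elements z equals X^12 - aX^10 - 33X^8 + 2aX^6 - 33X^4 - aX^2 + 1 with a = (t^12 - 33t^8 - 33t^4 + 1)/(t^2 (t^4 - 1)^2). -/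
open Polynomial

/-- The quartic with roots `±x` and `±y`, where `x * y = 1`. -/
theorem prod_X_sub_C_neg_of_mul_eq_one {K : Type*} [Field K] {x y : K} (h : x * y = 1) :
    (X - C x) * (X - C (-x)) * (X - C y) * (X - C (-y))
      = X ^ 4 - C (x ^ 2 + y ^ 2) * X ^ 2 + 1 := by
  have hC : C x * C y = 1 := by rw [← C_mul, h, C_1]
  simp only [C_neg, C_add, C_pow]
  linear_combination (C x * C y + 1) * hC

/-- The product of three palindromic biquadratics in terms of the elementary symmetric functions
of their middle coefficients. -/
theorem prod_palindromic_quartics {K : Type*} [Field K] {p q r a : K} (h1 : p + q + r = a)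
    (h2 : p * q + p * r + q * r = -36) (h3 : p * q * r = -4 * a) :
    (X ^ 4 - C p * X ^ 2 + 1) * (X ^ 4 - C q * X ^ 2 + 1) * (X ^ 4 - C r * X ^ 2 + 1)
      = X ^ 12 - C a * X ^ 10 - 33 * X ^ 8 + 2 * C a * X ^ 6 - 33 * X ^ 4 - C a * X ^ 2 + 1 := by
  have e1 : C p + C q + C r = C a := by simp only [← h1, C_add]
  have e2 : C p * C q + C p * C r + C q * C r = (-36 : K[X]) := by
    simpa only [C_add, C_mul, C_neg, C_ofNat] using congrArg C h2
  have e3 : C p * C q * C r = (-4 : K[X]) * C a := by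
    simpa only [C_mul, C_neg, C_ofNat] using congrArg C h3
  linear_combination (-X ^ 10 - 2 * X ^ 6 - X ^ 2) * e1 + (X ^ 8 + X ^ 4) * e2 - X ^ 6 * e3

/-- The image of a fraction under the Möbius map `z ↦ (z - i) / (z + i)`, checked by
cross-multiplication. -/
theorem cayley_div {K : Type*} [Field K] {i b d b' d' : K} (hd : d ≠ 0) (hd' : d' ≠ 0)
    (hb : b + i * d ≠ 0) (h : (b - i * d) * d' = b' * (b + i * d)) :
    (b / d - i) / (b / d + i) = b' / d' := by
  have e : ∀ c : K, b / d + c = (b + c * d) / d := fun c => by field_simp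
  rw [sub_eq_add_neg, e, e, div_div_div_cancel_right₀ hd, div_eq_div_iff hb hd']
  linear_combination h

/-- Let `K` be a field of odd characteristic containing `i` with `i² = -1`, and
`t ∈ K` with `t(t⁴-1) ≠ 0`.  The orbit of `t` under the `A₄`-subgroup of `PGL(2,K)` generated
by `x ↦ -x` and `x ↦ (x-i)/(x+i)` consists of the listed `12` elements: the list contains `t`,
its element set is stable under the two generating Möbius maps, and it is the smallest such
set (hence it is exactly the orbit).  Moreover `∏ (X - z)` over the `12` listed elements equals
`X¹² - aX¹⁰ - 33X⁸ + 2aX⁶ - 33X⁴ - aX² + 1` with `a = (t¹²-33t⁸-33t⁴+1)/(t²(t⁴-1)²)`. -/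
theorem stmt_6 (K : Type*) [Field K] (h2 : (2 : K) ≠ 0) (i : K) (hi : i ^ 2 = -1)
    (t : K) (ht : t * (t ^ 4 - 1) ≠ 0)
    (L : List K)
    (hL : L = [t, -t, (t - i) / (t + i), -((t - i) / (t + i)), (t + i) / (t - i),
      -((t + i) / (t - i)), -i * (t + 1) / (t - 1), i * (t + 1) / (t - 1),
      -i * (t - 1) / (t + 1), i * (t - 1) / (t + 1), -1 / t, 1 / t])
    (S : Set K) (hS : S = {z | z ∈ L})
    (a : K) (ha : a = (t ^ 12 - 33 * t ^ 8 - 33 * t ^ 4 + 1) / (t ^ 2 * (t ^ 4 - 1) ^ 2)) :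
    t ∈ S ∧
    (∀ z ∈ S, -z ∈ S ∧ (z - i) / (z + i) ∈ S) ∧
    (∀ T : Set K, t ∈ T → (∀ z ∈ T, -z ∈ T ∧ (z - i) / (z + i) ∈ T) → S ⊆ T) ∧
    (L.map fun z => (X : Polynomial K) - C z).prod
      = X ^ 12 - C a * X ^ 10 - 33 * X ^ 8 + 2 * C a * X ^ 6 - 33 * X ^ 4 - C a * X ^ 2 + 1 := by
  have hi0 : i ≠ 0 := by rintro rfl; simp at hi
  have ht0 : t ≠ 0 := left_ne_zero_of_mul ht
  have hfac : (t - 1) * (t + 1) * ((t - i) * (t + i)) ≠ 0 := by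
    convert right_ne_zero_of_mul ht using 1
    linear_combination (1 - t ^ 2) * hi
  have hm : t - 1 ≠ 0 := left_ne_zero_of_mul (left_ne_zero_of_mul hfac)
  have hp : t + 1 ≠ 0 := right_ne_zero_of_mul (left_ne_zero_of_mul hfac)
  have hmi : t - i ≠ 0 := left_ne_zero_of_mul (right_ne_zero_of_mul hfac)
  have hpi : t + i ≠ 0 := right_ne_zero_of_mul (right_ne_zero_of_mul hfac)
  have h1i : 1 + i ≠ 0 := fun h => h2 (by linear_combination (1 - i) * h + hi)
  have h1mi : 1 - i ≠ 0 := fun h => h2 (by linear_combination (1 + i) * h + hi)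
  have f2 : (-t - i) / (-t + i) = (t + i) / (t - i) := by
    rw [← neg_div_neg_eq]
    congr 1 <;> ring
  have f3 : ((t - i) / (t + i) - i) / ((t - i) / (t + i) + i) = -i * (t + 1) / (t - 1) := by
    refine cayley_div hpi hm ?_ ?_
    · convert mul_ne_zero h1i hm using 1
      linear_combination hi
    · linear_combination (t ^ 2 + i * t - t + i) * hi
  have f4 : (-((t - i) / (t + i)) - i) / (-((t - i) / (t + i)) + i) = i * (t - 1) / (t + 1) := by
    rw [← neg_div]
    refine cayley_div hpi hp ?_ ?_
    · convert mul_ne_zero (neg_ne_zero.2 h1mi) hp using 1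
      linear_combination hi
    · linear_combination (i - t ^ 2 - t - i * t) * hi
  have f5 : ((t + i) / (t - i) - i) / ((t + i) / (t - i) + i) = -i * (t - 1) / (t + 1) := by
    refine cayley_div hmi hp ?_ ?_
    · convert mul_ne_zero h1i hp using 1
      linear_combination -hi
    · linear_combination (t ^ 2 + t - i * t + i) * hi
  have f6 : (-((t + i) / (t - i)) - i) / (-((t + i) / (t - i)) + i) = i * (t + 1) / (t - 1) := by
    rw [← neg_div]
    refine cayley_div hmi hm ?_ ?_
    · convert mul_ne_zero (neg_ne_zero.2 h1mi) hm using 1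
      linear_combination -hi
    · linear_combination (i * t - t ^ 2 + t + i) * hi
  have f7 : (-i * (t + 1) / (t - 1) - i) / (-i * (t + 1) / (t - 1) + i) = t := by
    refine (cayley_div hm one_ne_zero ?_ ?_).trans (div_one _)
    · convert mul_ne_zero h2 (neg_ne_zero.2 hi0) using 1
      ring
    · ring
  have f8 : (i * (t + 1) / (t - 1) - i) / (i * (t + 1) / (t - 1) + i) = 1 / t := by
    refine cayley_div hm ht0 ?_ ?_
    · convert mul_ne_zero h2 (mul_ne_zero hi0 ht0) using 1
      ring
    · ring
  have f9 : (-i * (t - 1) / (t + 1) - i) / (-i * (t - 1) / (t + 1) + i) = -t := by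
    refine (cayley_div hp one_ne_zero ?_ ?_).trans (div_one _)
    · convert mul_ne_zero h2 hi0 using 1
      ring
    · ring
  have f10 : (i * (t - 1) / (t + 1) - i) / (i * (t - 1) / (t + 1) + i) = -1 / t := by
    refine cayley_div hp ht0 ?_ ?_
    · convert mul_ne_zero h2 (mul_ne_zero hi0 ht0) using 1
      ring
    · ring
  have f11 : (-1 / t - i) / (-1 / t + i) = -((t - i) / (t + i)) := by
    rw [← neg_div]
    refine cayley_div ht0 hpi ?_ ?_
    · convert mul_ne_zero hi0 hpi using 1
      linear_combination -hi
    · linear_combination -2 * t * hi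
  have f12 : (1 / t - i) / (1 / t + i) = -((t + i) / (t - i)) := by
    rw [← neg_div]
    refine cayley_div ht0 hmi ?_ ?_
    · convert mul_ne_zero hi0 hmi using 1
      linear_combination hi
    · linear_combination 2 * t * hi
  have n7 : -(-i * (t + 1) / (t - 1)) = i * (t + 1) / (t - 1) := by ring
  have n9 : -(-i * (t - 1) / (t + 1)) = i * (t - 1) / (t + 1) := by ring
  have n8 : -(i * (t + 1) / (t - 1)) = -i * (t + 1) / (t - 1) := by ring
  have n10 : -(i * (t - 1) / (t + 1)) = -i * (t - 1) / (t + 1) := by ring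
  have n11 : -(-1 / t) = 1 / t := by ring
  have n12 : -(1 / t) = -1 / t := by ring
  subst hS hL
  refine ⟨by simp, ?_, ?_, ?_⟩
  · intro z hz
    simp only [Set.mem_ofPred_eq, List.mem_cons, List.not_mem_nil, or_false] at hz ⊢
    rcases hz with rfl | rfl | rfl | rfl | rfl | rfl | rfl | rfl | rfl | rfl | rfl | rfl
    · simp only [true_or, or_true, and_self]
    all_goals
      simp only [neg_neg, f2, f3, f4, f5, f6, f7, f8, f9, f10, f11, f12, n7, n8, n9, n10, n11, n12,
        true_or, or_true, and_self]
  · intro T hT hcl z hz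
    have hneg : ∀ {z}, z ∈ T → -z ∈ T := fun h => (hcl _ h).1
    have hmap : ∀ {z w}, (z - i) / (z + i) = w → z ∈ T → w ∈ T := fun e h => e ▸ (hcl _ h).2
    have m2 := hneg hT
    have m3 := hmap rfl hT
    have m4 := hneg m3
    have m5 := hmap f2 m2
    have m6 := hneg m5
    have m7 := hmap f3 m3
    have m8 := hmap f6 m6
    have m9 := hmap f5 m5
    have m10 := hmap f4 m4
    have m11 := hmap f10 m10
    have m12 := hmap f8 m8
    simp only [Set.mem_ofPred_eq, List.mem_cons, List.not_mem_nil, or_false] at hz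
    rcases hz with rfl | rfl | rfl | rfl | rfl | rfl | rfl | rfl | rfl | rfl | rfl | rfl <;>
      assumption
  · have hq : t ^ 2 + 1 ≠ 0 := by
      convert mul_ne_zero hmi hpi using 1
      linear_combination hi
    have hfour : t ^ 4 - 1 = (t - 1) * (t + 1) * (t ^ 2 + 1) := by ring
    have q1 := prod_X_sub_C_neg_of_mul_eq_one (x := t) (y := 1 / t) (by field_simp)
    have q2 := prod_X_sub_C_neg_of_mul_eq_one (x := (t - i) / (t + i)) (y := (t + i) / (t - i))
      (by field_simp)
    have q3 := prod_X_sub_C_neg_of_mul_eq_one (x := -i * (t + 1) / (t - 1))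
      (y := i * (t - 1) / (t + 1))
      (by field_simp; linear_combination -hi)
    have s2 : ((t - i) / (t + i)) ^ 2 + ((t + i) / (t - i)) ^ 2
        = 2 * (t ^ 4 - 6 * t ^ 2 + 1) / (t ^ 2 + 1) ^ 2 := by
      rw [show t ^ 2 + 1 = (t - i) * (t + i) by linear_combination hi]
      field_simp
      linear_combination (12 * t ^ 2 + 2 * i ^ 2 - 2) * hi
    have s3 : (-i * (t + 1) / (t - 1)) ^ 2 + (i * (t - 1) / (t + 1)) ^ 2
        = -(2 * (t ^ 4 + 6 * t ^ 2 + 1)) / ((t - 1) * (t + 1)) ^ 2 := by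
      field_simp
      linear_combination (2 * (t ^ 4 + 6 * t ^ 2 + 1)) * hi
    rw [s2] at q2
    rw [s3] at q3
    rw [hfour] at ha
    rw [← prod_palindromic_quartics (a := a) (p := t ^ 2 + (1 / t) ^ 2)
      (q := 2 * (t ^ 4 - 6 * t ^ 2 + 1) / (t ^ 2 + 1) ^ 2)
      (r := -(2 * (t ^ 4 + 6 * t ^ 2 + 1)) / ((t - 1) * (t + 1)) ^ 2), ← q1, ← q2, ← q3,
      n7, n10, n12]
    · simp only [List.map_cons, List.map_nil, List.prod_cons, List.prod_nil]
      ring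
    · rw [ha]
      field_simp
      ring
    · field_simp
      ring
    · rw [ha]
      field_simp
      ring
end

section
/- Let K be a field of odd characteristic and consider the function field K(θ, η) with η^2 = θ^6 - aθ^5 - 33θ^4 + 2aθ^3 - 33θ^2 - aθ + 1, where a^2 + 108 ≠ 0. The map β₂ : (θ, η) ↦ (1/θ, η/θ^3) is an involutory automorphism of this function field, and the elements x̃ = -(θ-1)^2/(θ+1)^2 and ỹ = -η/(θ+1)^3 are fixed by β₂ and satisfy ỹ^2 = x̃^3 + ((a+6)/4) x̃^2 + ((a-6)/4) x̃ - 1. -/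
open Polynomial

/-- Two `K`-algebra homomorphisms out of `K(X)` agree when they agree at `X`. -/
theorem RatFunc.algHom_ext_of_X {K L : Type*} [Field K] [Field L] [Algebra K L]
    {f g : RatFunc K →ₐ[K] L} (h : f RatFunc.X = g RatFunc.X) : f = g := by
  have hpoly : f.comp (IsScalarTower.toAlgHom K K[X] (RatFunc K)) =
      g.comp (IsScalarTower.toAlgHom K K[X] (RatFunc K)) := by
    apply Polynomial.algHom_ext
    simpa [RatFunc.algebraMap_X] using h
  ext x
  induction x using RatFunc.induction_on with
  | f q r hr =>
    have hq := DFunLike.congr_fun hpoly q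
    have hr' := DFunLike.congr_fun hpoly r
    simp only [AlgHom.comp_apply, IsScalarTower.coe_toAlgHom'] at hq hr'
    rw [map_div₀, map_div₀, hq, hr']

/-- A transcendental element `t` of `L` defines a `K`-algebra homomorphism `K(X) → L`, `X ↦ t`. -/
theorem RatFunc.exists_algHom_X_eq {K L : Type*} [Field K] [Field L] [Algebra K L] {t : L}
    (ht : Transcendental K t) : ∃ f : RatFunc K →ₐ[K] L, f RatFunc.X = t := by
  refine ⟨RatFunc.liftAlgHom (aeval t) (nonZeroDivisors_le_comap_nonZeroDivisors_of_injective _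
    (transcendental_iff_injective.mp ht)), ?_⟩
  have h := RatFunc.liftAlgHom_apply_div (aeval (R := K) t)
    (nonZeroDivisors_le_comap_nonZeroDivisors_of_injective _
      (transcendental_iff_injective.mp ht)) Polynomial.X 1
  simpa using h

/-- In the function field `K(θ,η)` with
`η² = θ⁶ - aθ⁵ - 33θ⁴ + 2aθ³ - 33θ² - aθ + 1` (realized as `AdjoinRoot p` over
`K(θ) = RatFunc K`), the map `β₂ : (θ,η) ↦ (1/θ, η/θ³)` is an involutory `K`-automorphism,
and `x̃ = -(θ-1)²/(θ+1)²`, `ỹ = -η/(θ+1)³` are fixed by `β₂` and satisfy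
`ỹ² = x̃³ + ((a+6)/4)x̃² + ((a-6)/4)x̃ - 1`. -/
theorem stmt_7 (K : Type*) [Field K] (h2 : (2 : K) ≠ 0) (a : K) (ha : a ^ 2 + 108 ≠ 0)
    (p : Polynomial (RatFunc K))
    (hp : p = X ^ 2 - C ((RatFunc.X : RatFunc K) ^ 6 - RatFunc.C a * RatFunc.X ^ 5
      - 33 * RatFunc.X ^ 4 + 2 * RatFunc.C a * RatFunc.X ^ 3 - 33 * RatFunc.X ^ 2
      - RatFunc.C a * RatFunc.X + 1))
    [Fact (Irreducible p)] :
    ∃ β₂ : AdjoinRoot p ≃ₐ[K] AdjoinRoot p,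
      let θ : AdjoinRoot p := AdjoinRoot.of p RatFunc.X
      let η : AdjoinRoot p := AdjoinRoot.root p
      let aF : AdjoinRoot p := algebraMap K (AdjoinRoot p) a
      let xt : AdjoinRoot p := -(θ - 1) ^ 2 / (θ + 1) ^ 2
      let yt : AdjoinRoot p := -η / (θ + 1) ^ 3
      β₂ θ = 1 / θ ∧ β₂ η = η / θ ^ 3 ∧ β₂ * β₂ = 1 ∧
      β₂ xt = xt ∧ β₂ yt = yt ∧
      yt ^ 2 = xt ^ 3 + (aF + 6) / 4 * xt ^ 2 + (aF - 6) / 4 * xt - 1 := by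
  set θ : AdjoinRoot p := AdjoinRoot.of p RatFunc.X
  set η : AdjoinRoot p := AdjoinRoot.root p
  set aF : AdjoinRoot p := algebraMap K (AdjoinRoot p) a
  have hC (c : K) : AdjoinRoot.of p (RatFunc.C c) = algebraMap K (AdjoinRoot p) c := by
    rw [← RatFunc.algebraMap_eq_C]
    rfl
  have hθtr : Transcendental K θ := by
    have h := (transcendental_algebraMap_iff (R := K)
      (algebraMap (RatFunc K) (AdjoinRoot p)).injective).mpr RatFunc.transcendental_X
    simpa [AdjoinRoot.algebraMap_eq] using h
  have hθ0 : θ ≠ 0 := fun h => hθtr (h ▸ isAlgebraic_zero)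
  have hθ1 : θ + 1 ≠ 0 := fun h => by
    refine hθtr ?_
    rw [eq_neg_of_add_eq_zero_left h]
    exact isAlgebraic_one.neg
  have h2' : (2 : AdjoinRoot p) ≠ 0 := by
    simpa only [map_ofNat] using (map_ne_zero (algebraMap K (AdjoinRoot p))).mpr h2
  have h4 : (4 : AdjoinRoot p) ≠ 0 := by
    have := mul_ne_zero h2' h2'
    norm_num at this
    exact this
  have heval (g : RatFunc K →+* AdjoinRoot p) (x : AdjoinRoot p) :
      p.eval₂ g x = x ^ 2 - (g RatFunc.X ^ 6 - g (RatFunc.C a) * g RatFunc.X ^ 5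
        - 33 * g RatFunc.X ^ 4 + 2 * g (RatFunc.C a) * g RatFunc.X ^ 3 - 33 * g RatFunc.X ^ 2
        - g (RatFunc.C a) * g RatFunc.X + 1) := by
    conv_lhs => enter [3]; rw [hp]
    rw [eval₂_sub, eval₂_pow, eval₂_X, eval₂_C]
    simp only [map_sub, map_add, map_mul, map_pow, map_one, map_ofNat]
  have hcurve : η ^ 2 = θ ^ 6 - aF * θ ^ 5 - 33 * θ ^ 4 + 2 * aF * θ ^ 3 - 33 * θ ^ 2
      - aF * θ + 1 := by
    have h := AdjoinRoot.eval₂_root p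
    rw [heval, hC] at h
    exact sub_eq_zero.mp h
  obtain ⟨i, hi⟩ := RatFunc.exists_algHom_X_eq (K := K) (t := θ⁻¹)
    (fun h => hθtr (IsAlgebraic.inv_iff.mp h))
  have hiC : i (RatFunc.C a) = aF := by
    rw [← RatFunc.algebraMap_eq_C, AlgHom.commutes]
  have hroot : p.eval₂ (i : RatFunc K →+* AdjoinRoot p) (η / θ ^ 3) = 0 := by
    rw [heval, RingHom.coe_coe, hi, hiC, div_pow, hcurve]
    field_simp
    ring
  let f : AdjoinRoot p →ₐ[K] AdjoinRoot p := AdjoinRoot.liftAlgHom p i (η / θ ^ 3) hroot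
  have hfθ : f θ = θ⁻¹ := (AdjoinRoot.liftAlgHom_of p i _ hroot _).trans hi
  have hfη : f η = η / θ ^ 3 := AdjoinRoot.liftAlgHom_root p i _ hroot
  have hff : f.comp f = AlgHom.id K _ := by
    apply AdjoinRoot.algHom_ext'
    · apply RatFunc.algHom_ext_of_X
      change f (f θ) = θ
      rw [hfθ, map_inv₀, hfθ, inv_inv]
    · change f (f η) = η
      rw [hfη, map_div₀, map_pow, hfη, hfθ]
      field_simp
  refine ⟨AlgEquiv.ofAlgHom f f hff hff, ?_⟩
  have hθ1' : θ⁻¹ + 1 ≠ 0 := by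
    intro h
    apply hθ1
    field_simp at h
    linear_combination h
  have hθ1'' : 1 + θ ≠ 0 := by rwa [add_comm]
  simp only [AlgEquiv.ofAlgHom_apply]
  refine ⟨by rw [hfθ, one_div], hfη, ?_, ?_, ?_, ?_⟩
  · ext x
    exact DFunLike.congr_fun hff x
  · simp only [map_div₀, map_neg, map_pow, map_sub, map_add, map_one, hfθ]
    field_simp
    ring
  · simp only [map_div₀, map_neg, map_pow, map_add, map_one, hfθ, hfη]
    field_simp
    ring
  · rw [div_pow, neg_sq, hcurve]
    field_simp
    ring
end
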